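/- For every b ∈ B(k) one has 𝔟_{P_{w0}·b} = Σ_{c ∈ 𝔠_n} (𝔟_{P_{w0}·b} ∩ 𝔟_{P_c})^{gr=w0}; in other words, when the Borel subalgebra 𝔟' equals 𝔟_{w0·b} for some b ∈ B(k), the element w' in the Borel-envelope lemma can be taken to be the identity permutation. -/

import Mathlib

/-- The permutation matrix `P_w ∈ GL_n(k)` determined by `P_w e_b = e_{w b}`. -/
def permMat (k : Type*) [Field k] {n : ℕ} (w : Equiv.Perm (Fin n)) :
    Matrix (Fin n) (Fin n) k :=
  Matrix.of fun a b => if a = w b then 1 else 0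

/-- `𝔟_g = g⁻¹ 𝔟 g`: the set of matrices `M` such that `g * M * g⁻¹` is upper
triangular (here `g'` stands for the inverse of `g`). -/
def borelConj {n : ℕ} {k : Type*} [Field k] (g g' : Matrix (Fin n) (Fin n) k) :
    Set (Matrix (Fin n) (Fin n) k) :=
  {M | ∀ a b : Fin n, b < a → (g * M * g') a b = 0}

/-- `(𝔟_g ∩ 𝔟_h)^{gr = w0}`: the matrices `M` in `𝔟_g ∩ 𝔟_h` such that
`(h M h⁻¹)_{ii} = (g M g⁻¹)_{w0(i), w0(i)}` for all `i`, where `w0 : i ↦ n+1-i`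
(`Fin.rev` in 0-indexed terms).  `g'` and `h'` stand for the inverses of `g`, `h`. -/
def grSet {n : ℕ} {k : Type*} [Field k] (g g' h h' : Matrix (Fin n) (Fin n) k) :
    Set (Matrix (Fin n) (Fin n) k) :=
  {M | M ∈ borelConj g g' ∧ M ∈ borelConj h h' ∧
    ∀ i : Fin n, (h * M * h') i i = (g * M * g') i.rev i.rev}

/-- `c` is the full cycle `c_{i,j} = (i, i-1, …, j+1, j)` (for `j ≤ i`). -/
def IsFullCycleAt {n : ℕ} (c : Equiv.Perm (Fin n)) (i j : Fin n) : Prop :=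
  c j = i ∧ (∀ a : Fin n, j < a → a ≤ i → (c a : ℕ) = (a : ℕ) - 1) ∧
    ∀ a : Fin n, ¬(j ≤ a ∧ a ≤ i) → c a = a

/-- `c ∈ 𝔠_n`, the set of full cycles `c_{i,j}` for `1 ≤ j ≤ i ≤ n`. -/
def IsFullCycle {n : ℕ} (c : Equiv.Perm (Fin n)) : Prop :=
  ∃ i j : Fin n, j ≤ i ∧ IsFullCycleAt c i j

theorem permMat_conj_apply {n : ℕ} {k : Type*} [Field k] (w : Equiv.Perm (Fin n))
    (M : Matrix (Fin n) (Fin n) k) (x y : Fin n) :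
    (permMat k w * M * permMat k w⁻¹) (w x) (w y) = M x y := by
  simp [permMat, Matrix.mul_apply]

theorem revPerm_conj_apply {n : ℕ} {k : Type*} [Field k]
    (b b' M : Matrix (Fin n) (Fin n) k) (x y : Fin n) :
    (permMat k (Fin.revPerm : Equiv.Perm (Fin n)) * b * M *
      (b' * permMat k ((Fin.revPerm : Equiv.Perm (Fin n))⁻¹))) x.rev y.rev =
        (b * M * b') x y := by
  rw [← permMat_conj_apply Fin.revPerm (b * M * b') x y]
  simp only [Matrix.mul_assoc, Fin.revPerm_apply]

/-- Membership in `𝔟_{w0 b}` means that the conjugate by `b` is lower triangular. -/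
theorem mem_borelConj_revPerm_mul_iff {n : ℕ} {k : Type*} [Field k]
    (b b' M : Matrix (Fin n) (Fin n) k) :
    M ∈ borelConj (permMat k (Fin.revPerm : Equiv.Perm (Fin n)) * b)
        (b' * permMat k ((Fin.revPerm : Equiv.Perm (Fin n))⁻¹)) ↔
      ∀ x y : Fin n, x < y → (b * M * b') x y = 0 := by
  constructor
  · intro h x y hxy
    rw [← revPerm_conj_apply]
    exact h _ _ (Fin.rev_lt_rev.mpr hxy)
  · intro h x y hxy
    have := h x.rev y.rev (Fin.rev_lt_rev.mpr hxy)
    rwa [← revPerm_conj_apply, Fin.rev_rev, Fin.rev_rev] at this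

/-- The graded intersection `(𝔟_{w0 b} ∩ 𝔟_c)^{gr = w0}` in terms of matrix entries. -/
theorem mem_grSet_revPerm_mul_iff {n : ℕ} {k : Type*} [Field k]
    (b b' M : Matrix (Fin n) (Fin n) k) (c : Equiv.Perm (Fin n)) :
    M ∈ grSet (permMat k (Fin.revPerm : Equiv.Perm (Fin n)) * b)
        (b' * permMat k ((Fin.revPerm : Equiv.Perm (Fin n))⁻¹)) (permMat k c) (permMat k c⁻¹) ↔
      (∀ x y : Fin n, x < y → (b * M * b') x y = 0) ∧
      (∀ x y : Fin n, c y < c x → M x y = 0) ∧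
      ∀ x : Fin n, M x x = (b * M * b') (c x) (c x) := by
  refine and_congr (mem_borelConj_revPerm_mul_iff b b' M) (and_congr ?_ ?_)
  · constructor
    · intro h x y hxy
      rw [← permMat_conj_apply c M x y]
      exact h _ _ hxy
    · intro h x y hxy
      have := h (c.symm x) (c.symm y) (by simpa using hxy)
      rw [← permMat_conj_apply c M] at this
      simpa only [Equiv.apply_symm_apply] using this
  · simp only [revPerm_conj_apply]
    constructor
    · intro h x
      rw [← permMat_conj_apply c M]
      exact h (c x)
    · intro h i
      obtain ⟨x, rfl⟩ := c.surjective i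
      rw [permMat_conj_apply c M]
      exact h x

/-- The Borel subalgebra `𝔟_g` as a linear subspace is closed under sums. -/
theorem sum_mem_borelConj {n : ℕ} {k ι : Type*} [Field k] (g g' : Matrix (Fin n) (Fin n) k)
    (s : Finset ι) (F : ι → Matrix (Fin n) (Fin n) k) (hF : ∀ p ∈ s, F p ∈ borelConj g g') :
    ∑ p ∈ s, F p ∈ borelConj g g' := by
  intro x y hxy
  rw [Finset.mul_sum, Finset.sum_mul, Matrix.sum_apply]
  exact Finset.sum_eq_zero fun p hp => hF p hp x y hxy

theorem sum_mem_grSet {n : ℕ} {k ι : Type*} [Field k] (g g' h h' : Matrix (Fin n) (Fin n) k)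
    (s : Finset ι) (F : ι → Matrix (Fin n) (Fin n) k) (hF : ∀ p ∈ s, F p ∈ grSet g g' h h') :
    ∑ p ∈ s, F p ∈ grSet g g' h h' := by
  refine ⟨sum_mem_borelConj _ _ s F fun p hp => (hF p hp).1,
    sum_mem_borelConj _ _ s F fun p hp => (hF p hp).2.1, fun i => ?_⟩
  simp only [Finset.mul_sum, Finset.sum_mul, Matrix.sum_apply]
  exact Finset.sum_congr rfl fun p hp => (hF p hp).2.2 i

theorem smul_mem_grSet {n : ℕ} {k : Type*} [Field k] {g g' h h' M : Matrix (Fin n) (Fin n) k}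
    (t : k) (hM : M ∈ grSet g g' h h') : t • M ∈ grSet g g' h h' := by
  refine ⟨fun x y hxy => ?_, fun x y hxy => ?_, fun i => ?_⟩
  · simp [hM.1 x y hxy]
  · simp [hM.2.1 x y hxy]
  · simp [hM.2.2 i]

theorem isFullCycleAt_cycleIcc_inv {n : ℕ} {i j : Fin n} (hji : j ≤ i) :
    IsFullCycleAt (Fin.cycleIcc j i)⁻¹ i j := by
  have : NeZero n := ⟨fun h => by subst h; exact i.elim0⟩
  refine ⟨?_, fun a hja hai => ?_, fun a ha => ?_⟩
  · rw [Equiv.Perm.inv_eq_iff_eq, Fin.cycleIcc_of_last hji]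
  · have ha : (a : ℕ) - 1 < n := by omega
    have key : (Fin.cycleIcc j i)⁻¹ a = ⟨(a : ℕ) - 1, ha⟩ := by
      rw [Equiv.Perm.inv_eq_iff_eq,
        Fin.cycleIcc_of_ge_of_lt (by simp [Fin.le_def]; omega) (by simp [Fin.lt_def]; omega)]
      ext
      rw [Fin.val_add_one_of_lt']
      · simp; omega
      · simp; omega
    rw [key]
  · rw [Equiv.Perm.inv_eq_iff_eq]
    rcases lt_or_ge a j with h | h
    · rw [Fin.cycleIcc_of_lt h]
    · rw [Fin.cycleIcc_of_gt (not_le.mp fun h' => ha ⟨h, h'⟩)]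

/-- The matrix whose only nonzero row is the `i`-th one, equal there to the `j`-th row of `b'`
truncated to the columns `≤ i`. -/
def truncatedRow {n : ℕ} {k : Type*} [Field k] (b' : Matrix (Fin n) (Fin n) k) (i j : Fin n) :
    Matrix (Fin n) (Fin n) k :=
  Matrix.of fun x y => if x = i ∧ y ≤ i then b' j y else 0

theorem truncatedRow_mul_apply {n : ℕ} {k : Type*} [Field k]
    {b b' : Matrix (Fin n) (Fin n) k} (hb'b : b' * b = 1)
    (hbu : ∀ a c : Fin n, c < a → b a c = 0) (i j : Fin n) {y : Fin n} (hy : y ≤ i) :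
    (truncatedRow b' i j * b) i y = if j = y then 1 else 0 := by
  rw [← Matrix.one_apply, ← hb'b, Matrix.mul_apply, Matrix.mul_apply]
  refine Finset.sum_congr rfl fun m _ => ?_
  by_cases hm : m ≤ i
  · simp [truncatedRow, hm]
  · simp [hbu m y (hy.trans_lt (not_le.mp hm))]

theorem conj_truncatedRow_apply {n : ℕ} {k : Type*} [Field k]
    (b b' : Matrix (Fin n) (Fin n) k) (i j x y : Fin n) :
    (b' * truncatedRow b' i j * b) x y = b' x i * (truncatedRow b' i j * b) i y := by
  rw [Matrix.mul_assoc, Matrix.mul_apply]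
  refine Finset.sum_eq_single i (fun m _ hm => ?_) (by simp)
  simp [Matrix.mul_apply, truncatedRow, hm]

theorem IsFullCycleAt.apply_le {n : ℕ} {c : Equiv.Perm (Fin n)} {i j : Fin n}
    (hc : IsFullCycleAt c i j) {x : Fin n} (hx : x ≤ i) : c x ≤ i := by
  rcases lt_trichotomy x j with h | rfl | h
  · rw [hc.2.2 x fun h' => absurd h'.1 (not_le.mpr h)]
    exact hx
  · exact hc.1.le
  · have := hc.2.1 x h hx
    rw [Fin.le_def] at *
    omega

theorem conj_truncatedRow_mem_grSet {n : ℕ} {k : Type*} [Field k]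
    {b b' : Matrix (Fin n) (Fin n) k} (hbb' : b * b' = 1) (hb'b : b' * b = 1)
    (hbu : ∀ a c : Fin n, c < a → b a c = 0) (hbu' : ∀ a c : Fin n, c < a → b' a c = 0)
    {c : Equiv.Perm (Fin n)} {i j : Fin n} (hji : j ≤ i) (hc : IsFullCycleAt c i j) :
    b' * truncatedRow b' i j * b ∈ grSet (permMat k (Fin.revPerm : Equiv.Perm (Fin n)) * b)
      (b' * permMat k ((Fin.revPerm : Equiv.Perm (Fin n))⁻¹)) (permMat k c) (permMat k c⁻¹) := by
  rw [mem_grSet_revPerm_mul_iff]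
  have hconj : b * (b' * truncatedRow b' i j * b) * b' = truncatedRow b' i j := by
    rw [Matrix.mul_assoc, Matrix.mul_assoc, hbb', Matrix.mul_one, ← Matrix.mul_assoc, hbb',
      Matrix.one_mul]
  simp only [hconj, conj_truncatedRow_apply]
  refine ⟨fun x y hxy => ?_, fun x y hxy => ?_, fun x => ?_⟩
  · refine if_neg ?_
    rintro ⟨rfl, h⟩
    exact absurd hxy (not_lt.mpr h)
  · rcases lt_or_ge i x with hx | hx
    · rw [hbu' x i hx, zero_mul]
    · have hcx := hc.apply_le hx
      rcases lt_or_ge i y with hy | hy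
      · rw [hc.2.2 y fun h => absurd h.2 (not_le.mpr hy)] at hxy
        exact absurd (hxy.trans_le hcx) (not_lt.mpr hy.le)
      · rw [truncatedRow_mul_apply hb'b hbu i j hy, if_neg, mul_zero]
        rintro rfl
        rw [hc.1] at hxy
        exact absurd hxy (not_lt.mpr hcx)
  · by_cases hxj : x = j
    · subst hxj
      rw [truncatedRow_mul_apply hb'b hbu i x hji, hc.1]
      simp [truncatedRow]
    · have hne : c x ≠ i := fun h => hxj (c.injective (h.trans hc.1.symm))
      have hzero : truncatedRow b' i j (c x) (c x) = 0 := if_neg fun h => hne h.1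
      rw [hzero]
      rcases lt_or_ge i x with hx | hx
      · rw [hbu' x i hx, zero_mul]
      · rw [truncatedRow_mul_apply hb'b hbu i j hx, if_neg (Ne.symm hxj), mul_zero]

/-- The truncated rows of an invertible upper triangular matrix span the lower triangular
matrices. -/
theorem sum_smul_truncatedRow {n : ℕ} {k : Type*} [Field k]
    {b b' N : Matrix (Fin n) (Fin n) k} (hbb' : b * b' = 1)
    (hbu' : ∀ a c : Fin n, c < a → b' a c = 0) (hN : ∀ x y : Fin n, x < y → N x y = 0) :
    ∑ p : Fin n × Fin n with p.2 ≤ p.1, (N * b) p.1 p.2 • truncatedRow b' p.1 p.2 = N := by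
  ext x y
  rw [Finset.sum_filter, Fintype.sum_prod_type, Matrix.sum_apply,
    Finset.sum_eq_single x (fun i _ hi => ?_) (by simp), Matrix.sum_apply]
  · rcases lt_or_ge x y with h | h
    · rw [hN x y h]
      refine Finset.sum_eq_zero fun j _ => ?_
      split_ifs <;> simp [truncatedRow, h]
    · trans (N * b * b') x y
      · rw [Matrix.mul_apply]
        refine Finset.sum_congr rfl fun j _ => ?_
        by_cases hj : j ≤ x
        · simp [truncatedRow, hj, h]
        · simp [hj, hbu' j y (h.trans_lt (not_le.mp hj))]
      · rw [Matrix.mul_assoc, hbb', Matrix.mul_one]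
  · rw [Matrix.sum_apply]
    refine Finset.sum_eq_zero fun j _ => ?_
    split_ifs <;> simp [truncatedRow, Ne.symm hi]

/-- For every `b ∈ B(k)`, one has
`𝔟_{P_{w0}·b} = Σ_{c ∈ 𝔠_n} (𝔟_{P_{w0}·b} ∩ 𝔟_{P_c})^{gr = w0}`
(the case `w' = 1` of the Borel-envelope lemma); here `w0 = Fin.revPerm`
and `b'` stands for the inverse of the invertible upper triangular matrix `b`. -/
theorem statement1 {n : ℕ} [NeZero n] {k : Type*} [Field k]
    (b b' : Matrix (Fin n) (Fin n) k) (hbb' : b * b' = 1) (hb'b : b' * b = 1)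
    (hbu : ∀ a c : Fin n, c < a → b a c = 0) :
    ∀ M : Matrix (Fin n) (Fin n) k,
      M ∈ borelConj (permMat k (Fin.revPerm : Equiv.Perm (Fin n)) * b)
          (b' * permMat k ((Fin.revPerm : Equiv.Perm (Fin n))⁻¹)) ↔
        ∃ f : Equiv.Perm (Fin n) → Matrix (Fin n) (Fin n) k,
          (∀ c : Equiv.Perm (Fin n), IsFullCycle c →
            f c ∈ grSet (permMat k (Fin.revPerm : Equiv.Perm (Fin n)) * b)
              (b' * permMat k ((Fin.revPerm : Equiv.Perm (Fin n))⁻¹))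
              (permMat k c) (permMat k c⁻¹)) ∧
          (∀ c : Equiv.Perm (Fin n), ¬IsFullCycle c → f c = 0) ∧
          M = ∑ c : Equiv.Perm (Fin n), f c := by
  have hbu' : ∀ a c : Fin n, c < a → b' a c = 0 := by
    have hinv : b⁻¹ = b' := Matrix.inv_eq_right_inv hbb'
    let _ : Invertible b := ⟨b', hb'b, hbb'⟩
    have h : b.BlockTriangular id := fun a c hac => hbu a c hac
    have h' := Matrix.blockTriangular_inv_of_blockTriangular h
    rw [hinv] at h'
    exact fun a c hac => h' hac
  intro M
  constructor
  · intro hM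
    rw [mem_borelConj_revPerm_mul_iff] at hM
    let T : Fin n × Fin n → Matrix (Fin n) (Fin n) k := fun p =>
      (b * M * b' * b) p.1 p.2 • (b' * truncatedRow b' p.1 p.2 * b)
    let S : Finset (Fin n × Fin n) := {p | p.2 ≤ p.1}
    let C : Fin n × Fin n → Equiv.Perm (Fin n) := fun p => (Fin.cycleIcc p.2 p.1)⁻¹
    have hS : ∀ p ∈ S, p.2 ≤ p.1 := fun p hp => (Finset.mem_filter.mp hp).2
    refine ⟨fun c => ∑ p ∈ S with C p = c, T p, fun c _ => ?_, fun c hc => ?_, ?_⟩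
    · refine sum_mem_grSet _ _ _ _ _ T fun p hp => ?_
      obtain ⟨hpS, rfl⟩ := Finset.mem_filter.mp hp
      exact smul_mem_grSet _ (conj_truncatedRow_mem_grSet hbb' hb'b hbu hbu' (hS p hpS)
        (isFullCycleAt_cycleIcc_inv (hS p hpS)))
    · refine Finset.sum_eq_zero fun p hp => ?_
      obtain ⟨hpS, rfl⟩ := Finset.mem_filter.mp hp
      exact absurd ⟨p.1, p.2, hS p hpS, isFullCycleAt_cycleIcc_inv (hS p hpS)⟩ hc
    · rw [Finset.sum_fiberwise]
      calc M = b' * (b * M * b') * b := by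
            rw [Matrix.mul_assoc, Matrix.mul_assoc, hb'b, Matrix.mul_one, ← Matrix.mul_assoc,
              hb'b, Matrix.one_mul]
        _ = b' * (∑ p ∈ S, (b * M * b' * b) p.1 p.2 • truncatedRow b' p.1 p.2) * b := by
            rw [sum_smul_truncatedRow hbb' hbu' hM]
        _ = ∑ p ∈ S, T p := by
            simp [T, Finset.mul_sum, Finset.sum_mul]
  · rintro ⟨f, hf, hf0, rfl⟩
    refine sum_mem_borelConj _ _ _ f fun c _ => ?_
    by_cases hc : IsFullCycle c
    · exact (hf c hc).1
    · rw [hf0 c hc]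
      intro x y _
      simp
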